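/- arXiv:1612.03863 — 2 statements merged into one kernel-verified Lean document; each statement's English description precedes it below -/
import Mathlib

section
/- Let f, h : [0,1] → ℝ be continuously differentiable with f(1) = 0 and h(1) = 0, and let g : [0,1] → ℝ be continuous with |g(x)| ≤ C for all x ∈ [0,1]. Then h(0) ∫₀¹ f(x) g(x) dx ≤ (1/4) ∫₀¹ f'(x)² dx + C² ∫₀¹ h'(x)² dx. -/
open MeasureTheory Set

/-- A `C¹` function on `[0,1]` vanishing at `1` is bounded pointwise by the `L²` norm of its
derivative. -/
theorem sq_le_integral_deriv_sq {u : ℝ → ℝ} (hu : ContDiffOn ℝ 1 u (Icc 0 1)) (hu1 : u 1 = 0)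
    {x : ℝ} (hx : x ∈ Icc (0 : ℝ) 1) :
    u x ^ 2 ≤ ∫ y in (0 : ℝ)..1, deriv u y ^ 2 := by
  set v := derivWithin u (Icc 0 1)
  have hv : ContinuousOn v (Icc 0 1) :=
    hu.continuousOn_derivWithin (uniqueDiffOn_Icc one_pos) le_rfl
  have heq : ∀ y ∈ Ioo (0 : ℝ) 1, deriv u y = v y := fun y hy =>
    (derivWithin_of_mem_nhds (Icc_mem_nhds hy.1 hy.2)).symm
  have hsq : ∫ y in (0 : ℝ)..1, deriv u y ^ 2 = ∫ y in (0 : ℝ)..1, v y ^ 2 := by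
    rw [intervalIntegral.integral_of_le zero_le_one, intervalIntegral.integral_of_le zero_le_one,
      integral_Ioc_eq_integral_Ioo, integral_Ioc_eq_integral_Ioo]
    exact setIntegral_congr_fun measurableSet_Ioo fun y hy => by simp only [heq y hy]
  have hsub : Icc x 1 ⊆ Icc (0 : ℝ) 1 := Icc_subset_Icc_left hx.1
  have hvi : IntervalIntegrable v volume x 1 :=
    (hv.mono hsub).intervalIntegrable_of_Icc hx.2
  have hvi2 : IntervalIntegrable (fun y => v y ^ 2) volume x 1 :=
    ((hv.pow 2).mono hsub).intervalIntegrable_of_Icc hx.2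
  have hvi2' : IntervalIntegrable (fun y => v y ^ 2) volume 0 1 :=
    (hv.pow 2).intervalIntegrable_of_Icc zero_le_one
  have hftc : ∫ y in x..1, v y = -u x := by
    rw [intervalIntegral.integral_eq_sub_of_hasDerivAt_of_le hx.2 (hu.continuousOn.mono hsub)
      (fun y hy => ?_) hvi, hu1, zero_sub]
    have hy' : y ∈ Ioo (0 : ℝ) 1 := ⟨hx.1.trans_lt hy.1, hy.2⟩
    have hd := (hu.differentiableOn one_ne_zero).differentiableAt (Icc_mem_nhds hy'.1 hy'.2)
    exact heq y hy' ▸ hd.hasDerivAt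
  have hyoung : ∫ y in x..1, 2 * (-u x) * v y ≤ ∫ y in x..1, (u x ^ 2 + v y ^ 2) :=
    intervalIntegral.integral_mono_on hx.2 (hvi.const_mul _)
      (intervalIntegrable_const.add hvi2) fun y _ => by nlinarith [sq_nonneg (u x + v y)]
  rw [intervalIntegral.integral_const_mul, hftc,
    intervalIntegral.integral_add intervalIntegrable_const hvi2,
    intervalIntegral.integral_const, smul_eq_mul] at hyoung
  have hmono : ∫ y in x..1, v y ^ 2 ≤ ∫ y in (0 : ℝ)..1, v y ^ 2 :=
    intervalIntegral.integral_mono_interval hx.1 hx.2 le_rfl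
      (Filter.Eventually.of_forall fun y => sq_nonneg (v y)) hvi2'
  rw [hsq]
  nlinarith [mul_nonneg hx.1 (sq_nonneg (u x))]

/-- the key cross-term estimate: if `f, h` are `C¹` on `[0,1]` with
`f(1) = h(1) = 0` and `|g| ≤ C` on `[0,1]`, then
`h(0) ∫₀¹ f g ≤ (1/4)∫₀¹ f'² + C² ∫₀¹ h'²`. -/
theorem cross_term_estimate
    (f h g : ℝ → ℝ) (C : ℝ)
    (hf : ContDiffOn ℝ 1 f (Icc 0 1))
    (hh : ContDiffOn ℝ 1 h (Icc 0 1))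
    (hf1 : f 1 = 0) (hh1 : h 1 = 0)
    (hg : ContinuousOn g (Icc 0 1))
    (hgC : ∀ x ∈ Icc (0:ℝ) 1, |g x| ≤ C) :
    h 0 * ∫ x in (0:ℝ)..1, f x * g x ≤
      (1 / 4) * (∫ x in (0:ℝ)..1, (deriv f x) ^ 2) +
        C ^ 2 * ∫ x in (0:ℝ)..1, (deriv h x) ^ 2 := by
  set A := ∫ x in (0 : ℝ)..1, deriv f x ^ 2
  set B := ∫ x in (0 : ℝ)..1, deriv h x ^ 2
  have hfA : ∀ x ∈ Icc (0 : ℝ) 1, |f x| ≤ √A := fun x hx =>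
    Real.abs_le_sqrt (sq_le_integral_deriv_sq hf hf1 hx)
  have hhB : |h 0| ≤ √B :=
    Real.abs_le_sqrt (sq_le_integral_deriv_sq hh hh1 (left_mem_Icc.2 zero_le_one))
  have hA : 0 ≤ A := intervalIntegral.integral_nonneg zero_le_one fun x _ => sq_nonneg _
  have hB : 0 ≤ B := intervalIntegral.integral_nonneg zero_le_one fun x _ => sq_nonneg _
  have hfg : |∫ x in (0 : ℝ)..1, f x * g x| ≤ √A * C := by
    have hle := intervalIntegral.norm_integral_le_of_norm_le_const (a := (0 : ℝ)) (b := 1)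
      (f := fun x => f x * g x) (C := √A * C) fun x hx => by
        rw [uIoc_of_le zero_le_one] at hx
        have hx' := Ioc_subset_Icc_self hx
        rw [Real.norm_eq_abs, abs_mul]
        exact mul_le_mul (hfA x hx') (hgC x hx') (abs_nonneg _) (Real.sqrt_nonneg _)
    simpa using hle
  calc h 0 * ∫ x in (0 : ℝ)..1, f x * g x
      ≤ |h 0| * |∫ x in (0 : ℝ)..1, f x * g x| := (le_abs_self _).trans (abs_mul _ _).le
    _ ≤ √B * (√A * C) := mul_le_mul hhB hfg (abs_nonneg _) (Real.sqrt_nonneg _)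
    _ ≤ 1 / 4 * √A ^ 2 + C ^ 2 * √B ^ 2 := by nlinarith [sq_nonneg (√A / 2 - C * √B)]
    _ = 1 / 4 * A + C ^ 2 * B := by rw [Real.sq_sqrt hA, Real.sq_sqrt hB]
end

section
/- Let λ₁, λ₂ ∈ ℝ, Ξ = {(ξ,η) ∈ ℝ² : 0 ≤ ξ ≤ 2, 0 ≤ η ≤ min(ξ, 2−ξ)}, and set M = max(1, |λ₁|, |λ₂|). Then there exist continuous functions G, H : Ξ → ℝ satisfying, for all (ξ,η) ∈ Ξ, the integral equations G(ξ,η) = (λ₂/2) ∫₀^η ∫₀^τ H(τ,s) ds dτ + (λ₂/4) ∫_η^ξ ∫₀^η H(τ,s) ds dτ and H(ξ,η) = −(λ₁/4)(ξ+η) + (λ₁/2) ∫₀^η ∫₀^τ G(τ,s) ds dτ + (λ₁/4) ∫_η^ξ ∫₀^η G(τ,s) ds dτ, together with the bounds |G(ξ,η)| ≤ M e^{M(ξ+η)} and |H(ξ,η)| ≤ M e^{M(ξ+η)}. -/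
open MeasureTheory Set

/-- The characteristic-coordinate domain `Ξ = {(ξ,η) : 0 ≤ ξ ≤ 2, 0 ≤ η ≤ min(ξ, 2−ξ)}`. -/
def XiDom : Set (ℝ × ℝ) :=
  {p : ℝ × ℝ | 0 ≤ p.1 ∧ p.1 ≤ 2 ∧ 0 ≤ p.2 ∧ p.2 ≤ min p.1 (2 - p.1)}

theorem integral_exp_const_mul {c : ℝ} (hc : c ≠ 0) (a b : ℝ) :
    ∫ x in a..b, Real.exp (c * x) = (Real.exp (c * b) - Real.exp (c * a)) / c := by
  rw [intervalIntegral.integral_comp_mul_left (fun x => Real.exp x) hc, integral_exp,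
    smul_eq_mul]
  field_simp

/-- The integral operator shared by both kernel equations, up to the factor `λᵢ`. -/
noncomputable def kernelIntegral (u : ℝ → ℝ → ℝ) (a b : ℝ) : ℝ :=
  (1 / 2) * (∫ τ in (0:ℝ)..b, ∫ s in (0:ℝ)..τ, u τ s) +
    (1 / 4) * ∫ τ in b..a, ∫ s in (0:ℝ)..b, u τ s

theorem continuous_inner_integral {u : ℝ → ℝ → ℝ} (hu : Continuous (Function.uncurry u)) :
    Continuous fun p : ℝ × ℝ => ∫ s in (0:ℝ)..p.2, u p.1 s :=
  intervalIntegral.continuous_parametric_intervalIntegral_of_continuous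
    (f := fun (p : ℝ × ℝ) s => u p.1 s) (by fun_prop) continuous_snd

theorem continuous_kernelIntegral {u : ℝ → ℝ → ℝ} (hu : Continuous (Function.uncurry u)) :
    Continuous fun p : ℝ × ℝ => kernelIntegral u p.1 p.2 := by
  have hI := continuous_inner_integral hu
  have hsub (p : ℝ × ℝ) : ∫ τ in p.2..p.1, ∫ s in (0:ℝ)..p.2, u τ s =
      (∫ τ in (0:ℝ)..p.1, ∫ s in (0:ℝ)..p.2, u τ s) -
        ∫ τ in (0:ℝ)..p.2, ∫ s in (0:ℝ)..p.2, u τ s := by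
    have hc : Continuous fun τ => ∫ s in (0:ℝ)..p.2, u τ s :=
      hI.comp (continuous_id.prodMk continuous_const)
    exact (intervalIntegral.integral_interval_sub_left (hc.intervalIntegrable _ _)
      (hc.intervalIntegrable _ _)).symm
  have hF : Continuous (Function.uncurry fun (p : ℝ × ℝ) τ => ∫ s in (0:ℝ)..p.2, u τ s) :=
    hI.comp (continuous_snd.prodMk (continuous_snd.comp continuous_fst))
  have hdiag : Continuous (Function.uncurry fun (_ : ℝ × ℝ) τ => ∫ s in (0:ℝ)..τ, u τ s) :=
    hI.comp (continuous_snd.prodMk continuous_snd)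
  simp only [kernelIntegral, hsub]
  exact (continuous_const.mul
      (intervalIntegral.continuous_parametric_intervalIntegral_of_continuous hdiag
        continuous_snd)).add
    (continuous_const.mul
      ((intervalIntegral.continuous_parametric_intervalIntegral_of_continuous hF
        continuous_fst).sub
      (intervalIntegral.continuous_parametric_intervalIntegral_of_continuous hF
        continuous_snd)))

theorem kernelIntegral_sub {u v : ℝ → ℝ → ℝ} (hu : Continuous (Function.uncurry u))
    (hv : Continuous (Function.uncurry v)) (a b : ℝ) :
    kernelIntegral (fun τ s => u τ s - v τ s) a b =
      kernelIntegral u a b - kernelIntegral v a b := by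
  have hin (τ c : ℝ) : ∫ s in (0:ℝ)..c, (u τ s - v τ s) =
      (∫ s in (0:ℝ)..c, u τ s) - ∫ s in (0:ℝ)..c, v τ s :=
    intervalIntegral.integral_sub
      (Continuous.intervalIntegrable (by fun_prop) _ _)
      (Continuous.intervalIntegrable (by fun_prop) _ _)
  have hd {w : ℝ → ℝ → ℝ} (hw : Continuous (Function.uncurry w)) :
      Continuous fun τ => ∫ s in (0:ℝ)..τ, w τ s :=
    (continuous_inner_integral hw).comp (continuous_id.prodMk continuous_id)
  have hc {w : ℝ → ℝ → ℝ} (hw : Continuous (Function.uncurry w)) :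
      Continuous fun τ => ∫ s in (0:ℝ)..b, w τ s :=
    (continuous_inner_integral hw).comp (continuous_id.prodMk continuous_const)
  simp only [kernelIntegral, hin]
  rw [intervalIntegral.integral_sub ((hd hu).intervalIntegrable _ _)
      ((hd hv).intervalIntegrable _ _),
    intervalIntegral.integral_sub ((hc hu).intervalIntegrable _ _)
      ((hc hv).intervalIntegrable _ _)]
  ring

theorem abs_kernelIntegral_le {u : ℝ → ℝ → ℝ} {M C : ℝ} (hM : 0 < M) (hC : 0 ≤ C)
    (hu : ∀ τ s, |u τ s| ≤ C * Real.exp (M * (τ + s))) {a b : ℝ} (hb : 0 ≤ b) (hab : b ≤ a) :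
    |kernelIntegral u a b| ≤ C / (4 * M ^ 2) * Real.exp (M * (a + b)) := by
  have hin {τ c : ℝ} (hc : 0 ≤ c) :
      |∫ s in (0:ℝ)..c, u τ s| ≤ C / M * Real.exp (M * c) * Real.exp (M * τ) := by
    have h := intervalIntegral.norm_integral_le_of_norm_le (μ := volume) (f := u τ) hc
      (g := fun s => C * Real.exp (M * τ) * Real.exp (M * s))
      (Filter.Eventually.of_forall fun s _ => by
        rw [mul_assoc, ← Real.exp_add, ← mul_add]; exact hu τ s)
      (Continuous.intervalIntegrable (by fun_prop) _ _)
    rw [intervalIntegral.integral_const_mul, integral_exp_const_mul hM.ne'] at h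
    refine h.trans ?_
    have : C * Real.exp (M * τ) * ((Real.exp (M * c) - Real.exp (M * 0)) / M) =
      C / M * (Real.exp (M * c) - 1) * Real.exp (M * τ) := by
        simp only [mul_zero, Real.exp_zero]; ring
    rw [this]
    gcongr
    linarith
  have h₁ : |∫ τ in (0:ℝ)..b, ∫ s in (0:ℝ)..τ, u τ s| ≤
      C / (2 * M ^ 2) * (Real.exp (M * b) * Real.exp (M * b)) := by
    have h := intervalIntegral.norm_integral_le_of_norm_le (μ := volume)
      (f := fun τ => ∫ s in (0:ℝ)..τ, u τ s) hb
      (g := fun τ => C / M * Real.exp (2 * M * τ))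
      (Filter.Eventually.of_forall fun τ hτ => by
        refine (hin hτ.1.le).trans_eq ?_
        rw [mul_assoc, ← Real.exp_add]; ring_nf)
      (Continuous.intervalIntegrable (by fun_prop) _ _)
    rw [intervalIntegral.integral_const_mul, integral_exp_const_mul (by positivity)] at h
    refine h.trans ?_
    have : C / M * ((Real.exp (2 * M * b) - Real.exp (2 * M * 0)) / (2 * M)) =
      C / (2 * M ^ 2) * (Real.exp (M * b) * Real.exp (M * b) - 1) := by
        rw [← Real.exp_add]; simp only [mul_zero, Real.exp_zero]; field_simp; ring_nf
    rw [this]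
    gcongr
    linarith
  have h₂ : |∫ τ in b..a, ∫ s in (0:ℝ)..b, u τ s| ≤
      C / M ^ 2 * (Real.exp (M * b) * (Real.exp (M * a) - Real.exp (M * b))) := by
    have h := intervalIntegral.norm_integral_le_of_norm_le (μ := volume)
      (f := fun τ => ∫ s in (0:ℝ)..b, u τ s) hab
      (g := fun τ => C / M * Real.exp (M * b) * Real.exp (M * τ))
      (Filter.Eventually.of_forall fun τ _ => hin hb)
      (Continuous.intervalIntegrable (by fun_prop) _ _)
    rw [intervalIntegral.integral_const_mul, integral_exp_const_mul hM.ne'] at h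
    refine h.trans_eq ?_
    field_simp
  calc |kernelIntegral u a b|
      ≤ (1 / 2) * |∫ τ in (0:ℝ)..b, ∫ s in (0:ℝ)..τ, u τ s| +
        (1 / 4) * |∫ τ in b..a, ∫ s in (0:ℝ)..b, u τ s| := by
        refine (abs_add_le _ _).trans_eq ?_
        rw [abs_mul, abs_mul]; norm_num
    _ ≤ (1 / 2) * (C / (2 * M ^ 2) * (Real.exp (M * b) * Real.exp (M * b))) +
        (1 / 4) * (C / M ^ 2 * (Real.exp (M * b) * (Real.exp (M * a) - Real.exp (M * b)))) := by
        gcongr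
    _ = C / (4 * M ^ 2) * Real.exp (M * (a + b)) := by
        rw [mul_add, Real.exp_add]; field_simp; ring

open scoped BoundedContinuousFunction

/-- Retraction of the plane onto the sector `0 ≤ η ≤ ξ`. -/
def sectorRetract (p : ℝ × ℝ) : ℝ × ℝ := (max p.1 0, max 0 (min p.2 (max p.1 0)))

theorem continuous_sectorRetract : Continuous sectorRetract := by
  unfold sectorRetract; fun_prop

theorem sectorRetract_snd_nonneg (p : ℝ × ℝ) : 0 ≤ (sectorRetract p).2 := le_max_left _ _

theorem sectorRetract_snd_le (p : ℝ × ℝ) : (sectorRetract p).2 ≤ (sectorRetract p).1 :=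
  max_le (le_max_right _ _) (min_le_right _ _)

theorem sectorRetract_of_mem {p : ℝ × ℝ} (hp : p ∈ XiDom) : sectorRetract p = p := by
  obtain ⟨h1, -, h3, h4⟩ := hp
  have h5 : p.2 ≤ p.1 := h4.trans (min_le_left _ _)
  ext <;> simp [sectorRetract, h1, h3, h5]

/-- The function `e^{M(ξ+η)} g(ξ,η)`. -/
noncomputable def expWeight (M : ℝ) (g : ℝ × ℝ →ᵇ ℝ) (τ s : ℝ) : ℝ :=
  Real.exp (M * (τ + s)) * g (τ, s)

theorem continuous_expWeight (M : ℝ) (g : ℝ × ℝ →ᵇ ℝ) :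
    Continuous (Function.uncurry (expWeight M g)) := by
  have := g.continuous
  unfold expWeight Function.uncurry
  fun_prop

theorem abs_expWeight_le (M : ℝ) (g : ℝ × ℝ →ᵇ ℝ) (τ s : ℝ) :
    |expWeight M g τ s| ≤ ‖g‖ * Real.exp (M * (τ + s)) := by
  rw [expWeight, abs_mul, Real.abs_exp, mul_comm]
  gcongr
  exact g.norm_coe_le_norm _

theorem abs_exp_neg_mul_le {x y c : ℝ} (h : |y| ≤ c * Real.exp x) : |Real.exp (-x) * y| ≤ c := by
  rw [abs_mul, Real.abs_exp, Real.exp_neg, inv_mul_le_iff₀ (Real.exp_pos _), mul_comm]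
  exact h

/-- The kernel integral operator conjugated by the weight `e^{M(ξ+η)}`. -/
noncomputable def weightedKernelIntegral {M : ℝ} (hM : 0 < M) (g : ℝ × ℝ →ᵇ ℝ) : ℝ × ℝ →ᵇ ℝ :=
  BoundedContinuousFunction.ofNormedAddCommGroup
    (fun p => Real.exp (-(M * ((sectorRetract p).1 + (sectorRetract p).2))) *
      kernelIntegral (expWeight M g) (sectorRetract p).1 (sectorRetract p).2)
    (by
      have h₁ := continuous_sectorRetract
      have h₂ := (continuous_kernelIntegral (continuous_expWeight M g)).comp h₁
      exact Continuous.mul (by fun_prop) h₂)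
    (‖g‖ / (4 * M ^ 2))
    (fun p => abs_exp_neg_mul_le (abs_kernelIntegral_le hM (norm_nonneg _)
      (abs_expWeight_le M g) (sectorRetract_snd_nonneg p) (sectorRetract_snd_le p)))

theorem weightedKernelIntegral_apply {M : ℝ} (hM : 0 < M) (g : ℝ × ℝ →ᵇ ℝ) (p : ℝ × ℝ) :
    weightedKernelIntegral hM g p =
      Real.exp (-(M * ((sectorRetract p).1 + (sectorRetract p).2))) *
        kernelIntegral (expWeight M g) (sectorRetract p).1 (sectorRetract p).2 := rfl

theorem norm_weightedKernelIntegral_le {M : ℝ} (hM : 0 < M) (g : ℝ × ℝ →ᵇ ℝ) :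
    ‖weightedKernelIntegral hM g‖ ≤ ‖g‖ / (4 * M ^ 2) :=
  BoundedContinuousFunction.norm_ofNormedAddCommGroup_le _ (by positivity) _

theorem weightedKernelIntegral_sub {M : ℝ} (hM : 0 < M) (g h : ℝ × ℝ →ᵇ ℝ) :
    weightedKernelIntegral hM (g - h) =
      weightedKernelIntegral hM g - weightedKernelIntegral hM h := by
  ext p
  have : expWeight M (g - h) = fun τ s => expWeight M g τ s - expWeight M h τ s := by
    funext τ s; simp [expWeight, mul_sub]
  simp only [BoundedContinuousFunction.sub_apply, weightedKernelIntegral_apply, this,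
    kernelIntegral_sub (continuous_expWeight M g) (continuous_expWeight M h), mul_sub]

theorem norm_smul_weightedKernelIntegral_le {M l : ℝ} (hM : 1 ≤ M) (hl : |l| ≤ M)
    (g : ℝ × ℝ →ᵇ ℝ) :
    ‖l • weightedKernelIntegral (zero_lt_one.trans_le hM) g‖ ≤ 1 / 4 * ‖g‖ := by
  have hM' : 0 < M := zero_lt_one.trans_le hM
  rw [norm_smul, Real.norm_eq_abs]
  calc |l| * ‖weightedKernelIntegral hM' g‖ ≤ M * (‖g‖ / (4 * M ^ 2)) := by
        gcongr
        exact norm_weightedKernelIntegral_le hM' g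
    _ = 1 / 4 * (‖g‖ / M) := by field_simp
    _ ≤ 1 / 4 * ‖g‖ := by
        gcongr
        exact div_le_self (norm_nonneg _) hM

/-- The inhomogeneity `-(l/4)(ξ+η)` divided by the weight `e^{M(ξ+η)}`. -/
noncomputable def weightedSource {M l : ℝ} (hl : |l| ≤ M) : ℝ × ℝ →ᵇ ℝ :=
  BoundedContinuousFunction.ofNormedAddCommGroup
    (fun p => Real.exp (-(M * ((sectorRetract p).1 + (sectorRetract p).2))) *
      (-(l / 4) * ((sectorRetract p).1 + (sectorRetract p).2)))
    (by
      have h₁ := continuous_sectorRetract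
      fun_prop)
    (1 / 4)
    (fun p => by
      refine abs_exp_neg_mul_le ?_
      have h₀ : 0 ≤ (sectorRetract p).1 + (sectorRetract p).2 := by
        have h₁ := sectorRetract_snd_nonneg p
        have h₂ := sectorRetract_snd_le p
        linarith
      have h₃ := mul_le_mul_of_nonneg_right hl h₀
      have h₄ := Real.add_one_le_exp (M * ((sectorRetract p).1 + (sectorRetract p).2))
      rw [abs_mul, abs_neg, abs_div, abs_of_nonneg h₀, abs_of_nonneg (zero_le_four (α := ℝ))]
      linarith)

theorem norm_weightedSource_le {M l : ℝ} (hl : |l| ≤ M) : ‖weightedSource hl‖ ≤ 1 / 4 :=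
  BoundedContinuousFunction.norm_ofNormedAddCommGroup_le (by fun_prop) (by positivity) _

theorem exists_weighted_solution {M l1 l2 : ℝ} (hM : 1 ≤ M) (h1 : |l1| ≤ M) (h2 : |l2| ≤ M) :
    ∃ g h : ℝ × ℝ →ᵇ ℝ,
      g = l2 • weightedKernelIntegral (zero_lt_one.trans_le hM) h ∧
      h = weightedSource h1 + l1 • weightedKernelIntegral (zero_lt_one.trans_le hM) g ∧
      ‖g‖ ≤ 1 ∧ ‖h‖ ≤ 1 := by
  let K := weightedKernelIntegral (zero_lt_one.trans_le hM)
  let Φ : (ℝ × ℝ →ᵇ ℝ) × (ℝ × ℝ →ᵇ ℝ) → (ℝ × ℝ →ᵇ ℝ) × (ℝ × ℝ →ᵇ ℝ) :=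
    fun x => (l2 • K x.2, weightedSource h1 + l1 • K x.1)
  have hK {l : ℝ} (hl : |l| ≤ M) (x y : ℝ × ℝ →ᵇ ℝ) :
      dist (l • K x) (l • K y) ≤ 1 / 4 * dist x y := by
    have hsub : l • K x - l • K y = l • K (x - y) := by
      rw [show K (x - y) = K x - K y from weightedKernelIntegral_sub _ x y, smul_sub]
    rw [dist_eq_norm, dist_eq_norm, hsub]
    exact norm_smul_weightedKernelIntegral_le hM hl _
  have hΦ : ContractingWith (1 / 4) Φ := by
    refine ⟨by rw [div_lt_one] <;> norm_num, LipschitzWith.of_dist_le_mul fun x y => ?_⟩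
    rw [Prod.dist_eq]
    push_cast
    refine max_le ((hK h2 _ _).trans ?_) ?_
    · gcongr
      exact le_max_right _ _
    · simp only [Φ, dist_add_left]
      refine (hK h1 _ _).trans ?_
      gcongr
      exact le_max_left _ _
  obtain ⟨⟨g, h⟩, hgh⟩ : ∃ x, Φ x = x := ⟨_, hΦ.fixedPoint_isFixedPt⟩
  obtain ⟨hg, hh⟩ := Prod.ext_iff.1 hgh
  have ng : ‖g‖ ≤ 1 / 4 * ‖h‖ := by
    conv_lhs => rw [← show l2 • K h = g from hg]
    exact norm_smul_weightedKernelIntegral_le hM h2 h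
  have nh : ‖h‖ ≤ 1 / 4 + 1 / 4 * ‖g‖ := by
    conv_lhs => rw [← show weightedSource h1 + l1 • K g = h from hh]
    refine (norm_add_le _ _).trans ?_
    gcongr
    · exact norm_weightedSource_le h1
    · exact norm_smul_weightedKernelIntegral_le hM h1 g
  exact ⟨g, h, hg.symm, hh.symm, by linarith [norm_nonneg h], by linarith [norm_nonneg g]⟩

/-- existence of continuous solutions of the kernel integral equations in
characteristic coordinates, with the exponential bound `M e^{M(ξ+η)}`,
`M = max(1, |λ₁|, |λ₂|)`. -/
theorem kernel_integral_equations_existence (l1 l2 : ℝ) :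
    ∀ M : ℝ, M = max 1 (max |l1| |l2|) →
    ∃ G H : ℝ → ℝ → ℝ,
      ContinuousOn (fun p : ℝ × ℝ => G p.1 p.2) XiDom ∧
      ContinuousOn (fun p : ℝ × ℝ => H p.1 p.2) XiDom ∧
      (∀ p ∈ XiDom,
        G p.1 p.2 =
          (l2 / 2) * (∫ τ in (0:ℝ)..p.2, ∫ s in (0:ℝ)..τ, H τ s) +
            (l2 / 4) * ∫ τ in p.2..p.1, ∫ s in (0:ℝ)..p.2, H τ s) ∧
      (∀ p ∈ XiDom,
        H p.1 p.2 =
          -(l1 / 4) * (p.1 + p.2) +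
            (l1 / 2) * (∫ τ in (0:ℝ)..p.2, ∫ s in (0:ℝ)..τ, G τ s) +
              (l1 / 4) * ∫ τ in p.2..p.1, ∫ s in (0:ℝ)..p.2, G τ s) ∧
      (∀ p ∈ XiDom, |G p.1 p.2| ≤ M * Real.exp (M * (p.1 + p.2))) ∧
      (∀ p ∈ XiDom, |H p.1 p.2| ≤ M * Real.exp (M * (p.1 + p.2))) := by
  intro M hMdef
  have hM : 1 ≤ M := hMdef ▸ le_max_left _ _
  have h1 : |l1| ≤ M := hMdef ▸ (le_max_left _ _).trans (le_max_right _ _)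
  have h2 : |l2| ≤ M := hMdef ▸ (le_max_right _ _).trans (le_max_right _ _)
  obtain ⟨g, h, hg, hh, ng, nh⟩ := exists_weighted_solution hM h1 h2
  have hexp (x y : ℝ) : Real.exp x * (Real.exp (-x) * y) = y := by
    rw [← mul_assoc, ← Real.exp_add, add_neg_cancel, Real.exp_zero, one_mul]
  have hbound {f : ℝ × ℝ →ᵇ ℝ} (nf : ‖f‖ ≤ 1) (p : ℝ × ℝ) :
      |expWeight M f p.1 p.2| ≤ M * Real.exp (M * (p.1 + p.2)) := by
    refine (abs_expWeight_le M f _ _).trans ?_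
    gcongr
    exact nf.trans hM
  refine ⟨expWeight M g, expWeight M h, (continuous_expWeight M g).continuousOn,
    (continuous_expWeight M h).continuousOn, fun p hp => ?_, fun p hp => ?_,
    fun p _ => hbound ng p, fun p _ => hbound nh p⟩
  · have key : expWeight M g p.1 p.2 = l2 * kernelIntegral (expWeight M h) p.1 p.2 := by
      rw [expWeight, hg, BoundedContinuousFunction.smul_apply, weightedKernelIntegral_apply,
        sectorRetract_of_mem hp, smul_eq_mul, mul_left_comm, hexp]
    rw [key, kernelIntegral]
    ring
  · have key : expWeight M h p.1 p.2 =
        -(l1 / 4) * (p.1 + p.2) + l1 * kernelIntegral (expWeight M g) p.1 p.2 := by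
      have hs : weightedSource h1 p =
          Real.exp (-(M * (p.1 + p.2))) * (-(l1 / 4) * (p.1 + p.2)) := by
        change Real.exp (-(M * ((sectorRetract p).1 + (sectorRetract p).2))) *
          (-(l1 / 4) * ((sectorRetract p).1 + (sectorRetract p).2)) = _
        rw [sectorRetract_of_mem hp]
      rw [expWeight, hh, BoundedContinuousFunction.add_apply,
        BoundedContinuousFunction.smul_apply, weightedKernelIntegral_apply,
        sectorRetract_of_mem hp, smul_eq_mul, hs, mul_add, hexp, mul_left_comm, hexp]
    rw [key, kernelIntegral]
    ring
end
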